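/- Proposition 1 (total uncertainty). For every unobserved node i ∈ U, u_total(i) = μ(E_{U \ {i}} | E_O ∩ {y | y i = g i}) / μ(E_U | E_O). In particular, since μ(E_U | E_O) does not depend on i, the total uncertainty u_total(i) is proportional, as a function of i ∈ U, to the posterior probability μ(E_{U \ {i}} | E_O ∩ {y | y i = g i}) of the remaining unobserved true labels after acquiring the true label of node i. -/

import Mathlib

open MeasureTheory ProbabilityTheory

/-- The event that all nodes in `S` carry their ground-truth label under `g`. -/
def groundTruthEvent {V : Type*} {C : ℕ} (g : V → Fin C) (S : Set V) :
    Set (V → Fin C) :=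
  {y | ∀ v ∈ S, y v = g v}

/-- If `A ∩ B ∩ T = A ∩ S`, then the inverse of the conditional probability of `B` given `A` is the
ratio of the probability of `T` given `A ∩ B` to the probability of `S` given `A`. -/
lemma inv_cond_apply_eq_div {Ω : Type*} [MeasurableSpace Ω] (μ : Measure Ω) [IsFiniteMeasure μ]
    {A B S T : Set Ω} (hA : MeasurableSet A) (hB : MeasurableSet B)
    (h : A ∩ B ∩ T = A ∩ S) (h0 : μ (A ∩ S) ≠ 0) :
    (μ[|A] B)⁻¹ = μ[|A ∩ B] T / μ[|A] S := by
  have hA0 : μ A ≠ 0 := fun hz => h0 (measure_mono_null Set.inter_subset_left hz)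
  rw [cond_apply hA, cond_apply (hA.inter hB), cond_apply hA, h,
    ENNReal.mul_div_mul_right _ _ h0 (measure_ne_top _ _),
    ENNReal.mul_inv (Or.inl (ENNReal.inv_ne_zero.2 (measure_ne_top _ _)))
      (Or.inl (ENNReal.inv_ne_top.2 hA0)), mul_comm, div_eq_mul_inv]

lemma groundTruthEvent_inter {V : Type*} {C : ℕ} (g : V → Fin C) (S T : Set V) :
    groundTruthEvent g S ∩ groundTruthEvent g T = groundTruthEvent g (S ∪ T) := by
  ext y
  simp [groundTruthEvent, or_imp, forall_and]

lemma groundTruthEvent_singleton {V : Type*} {C : ℕ} (g : V → Fin C) (i : V) :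
    groundTruthEvent g {i} = {y | y i = g i} := by
  simp [groundTruthEvent]

/-- **Proposition 1 (total uncertainty).**
For every unobserved node `i ∈ U = Oᶜ`,
`u_total(i) = μ(E_{U \ {i}} | E_O ∩ {y | y i = g i}) / μ(E_U | E_O)`.
In particular, since `μ(E_U | E_O)` does not depend on `i`, the total
uncertainty `u_total(i) = (c_total i)⁻¹` is proportional, as a function of
`i ∈ U`, to the posterior probability `μ(E_{U \ {i}} | E_O ∩ {y | y i = g i})`
of the remaining unobserved true labels after acquiring the true label of
node `i`. -/
theorem total_uncertainty_prop_posterior_after_acquisition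
    {V : Type*} [Fintype V] [Nonempty V] {C : ℕ} (hC : 1 ≤ C)
    [MeasurableSpace (V → Fin C)] [MeasurableSingletonClass (V → Fin C)]
    (μ : Measure (V → Fin C)) [IsProbabilityMeasure μ]
    (g : V → Fin C) (O : Set V)
    (hpos : 0 < μ (groundTruthEvent g Set.univ)) :
    (∀ i ∈ Oᶜ,
      (μ[|groundTruthEvent g O] {y | y i = g i})⁻¹
        = μ[|groundTruthEvent g O ∩ {y | y i = g i}]
              (groundTruthEvent g (Oᶜ \ {i}))
          / μ[|groundTruthEvent g O] (groundTruthEvent g Oᶜ))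
    ∧ ∃ k : ENNReal, 0 < k ∧ k ≠ ⊤ ∧ ∀ i ∈ Oᶜ,
        (μ[|groundTruthEvent g O] {y | y i = g i})⁻¹
          = k * μ[|groundTruthEvent g O ∩ {y | y i = g i}]
                  (groundTruthEvent g (Oᶜ \ {i})) := by
  have meas (s : Set (V → Fin C)) : MeasurableSet s := s.toFinite.measurableSet
  have hU : μ (groundTruthEvent g O ∩ groundTruthEvent g Oᶜ) ≠ 0 := by
    rw [groundTruthEvent_inter, Set.union_compl_self]
    exact hpos.ne'
  have key : ∀ i ∈ Oᶜ,
      (μ[|groundTruthEvent g O] {y | y i = g i})⁻¹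
        = μ[|groundTruthEvent g O ∩ {y | y i = g i}] (groundTruthEvent g (Oᶜ \ {i}))
          / μ[|groundTruthEvent g O] (groundTruthEvent g Oᶜ) := by
    intro i hi
    refine inv_cond_apply_eq_div μ (meas _) (meas _) ?_ hU
    rw [← groundTruthEvent_singleton, Set.inter_assoc, groundTruthEvent_inter,
      Set.union_sdiff_cancel (Set.singleton_subset_iff.2 hi)]
  refine ⟨key, (μ[|groundTruthEvent g O] (groundTruthEvent g Oᶜ))⁻¹,
    ENNReal.inv_pos.2 (measure_ne_top _ _),
    ENNReal.inv_ne_top.2 (cond_pos_of_inter_ne_zero (meas _) hU).ne', fun i hi => ?_⟩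
  rw [key i hi, div_eq_mul_inv, mul_comm]
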